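/- arXiv:1202.2003 — 12 statements merged into one kernel-verified Lean document; each statement's English description precedes it below -/
import Mathlib

section
/- Let 0 ≤ a < b < ∞ and let m₁, m₂ ∈ (0,1]. Suppose f, g : [0,∞) → [0,∞) are m₁-convex and m₂-convex respectively, and that the function x ↦ f(x)^((x-a)/(b-a)) · g(x)^((b-x)/(b-a)) is integrable on [a,b]. Then (1/(b-a)) ∫_a^b f(x)^((x-a)/(b-a)) g(x)^((b-x)/(b-a)) dx ≤ (1/3)[f(b) + m₂ g(a/m₂)] + (1/6)[g(b) + m₁ f(a/m₁)]. -/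
/-- The integral over `[a, b]` of a homogeneous quadratic in the barycentric coordinates. -/
lemma integral_barycentric_quadratic {a b : ℝ} (hab : a < b) (P Q R : ℝ) :
    ∫ x in a..b, (P * ((x - a) / (b - a)) ^ 2
      + Q * (((x - a) / (b - a)) * (1 - (x - a) / (b - a)))
      + R * (1 - (x - a) / (b - a)) ^ 2) = (b - a) * (P / 3 + Q / 6 + R / 3) := by
  have hne : b - a ≠ 0 := (sub_pos.2 hab).ne'
  have hderiv : ∀ x ∈ Set.uIcc a b, HasDerivAt
      (fun x => (b - a) * (P * ((x - a) / (b - a)) ^ 3 / 3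
        + Q * (((x - a) / (b - a)) ^ 2 / 2 - ((x - a) / (b - a)) ^ 3 / 3)
        - R * (1 - (x - a) / (b - a)) ^ 3 / 3))
      (P * ((x - a) / (b - a)) ^ 2
        + Q * (((x - a) / (b - a)) * (1 - (x - a) / (b - a)))
        + R * (1 - (x - a) / (b - a)) ^ 2) x := by
    intro x _
    have ht : HasDerivAt (fun x : ℝ => (x - a) / (b - a)) (1 / (b - a)) x :=
      ((hasDerivAt_id x).sub_const a).div_const _
    refine ((((((ht.pow 3).const_mul P).div_const 3).add
      ((((ht.pow 2).div_const 2).sub ((ht.pow 3).div_const 3)).const_mul Q)).sub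
      ((((ht.const_sub 1).pow 3).const_mul R).div_const 3)).const_mul (b - a)).congr_deriv ?_
    have hc : (b - a) * (1 / (b - a)) = 1 := mul_one_div_cancel hne
    generalize 1 / (b - a) = c at hc
    generalize (x - a) / (b - a) = t
    push_cast
    linear_combination (P * t ^ 2 + Q * (t * (1 - t)) + R * (1 - t) ^ 2) * hc
  rw [intervalIntegral.integral_eq_sub_of_hasDerivAt hderiv
    (Continuous.intervalIntegrable (by fun_prop) _ _), div_self hne, sub_self a, zero_div]
  ring

/-- Theorem 3 of the paper: for `m₁`-convex `f` and `m₂`-convex `g`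
(nonnegative functions on `[0,∞)`),
`(1/(b-a)) ∫_a^b f(x)^((x-a)/(b-a)) g(x)^((b-x)/(b-a)) dx
  ≤ (1/3)[f(b) + m₂ g(a/m₂)] + (1/6)[g(b) + m₁ f(a/m₁)]`. -/
theorem stmt_0 (a b m₁ m₂ : ℝ) (f g : ℝ → ℝ)
    (ha : 0 ≤ a) (hab : a < b)
    (hm₁ : m₁ ∈ Set.Ioc (0 : ℝ) 1) (hm₂ : m₂ ∈ Set.Ioc (0 : ℝ) 1)
    (hf0 : ∀ x, 0 ≤ x → 0 ≤ f x) (hg0 : ∀ x, 0 ≤ x → 0 ≤ g x)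
    (hf : ∀ x, 0 ≤ x → ∀ y, 0 ≤ y → ∀ t ∈ Set.Icc (0 : ℝ) 1,
      f (t * x + m₁ * (1 - t) * y) ≤ t * f x + m₁ * (1 - t) * f y)
    (hg : ∀ x, 0 ≤ x → ∀ y, 0 ≤ y → ∀ t ∈ Set.Icc (0 : ℝ) 1,
      g (t * x + m₂ * (1 - t) * y) ≤ t * g x + m₂ * (1 - t) * g y)
    (hint : IntervalIntegrable
      (fun x => f x ^ ((x - a) / (b - a)) * g x ^ ((b - x) / (b - a)))
      MeasureTheory.volume a b) :
    (1 / (b - a)) * ∫ x in a..b, f x ^ ((x - a) / (b - a)) * g x ^ ((b - x) / (b - a))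
      ≤ (1 / 3) * (f b + m₂ * g (a / m₂)) + (1 / 6) * (g b + m₁ * f (a / m₁)) := by
  have hba : 0 < b - a := sub_pos.2 hab
  have hmono := intervalIntegral.integral_mono_on hab.le hint
    (Continuous.intervalIntegrable
      (u := fun x => f b * ((x - a) / (b - a)) ^ 2
        + (m₁ * f (a / m₁) + g b) * (((x - a) / (b - a)) * (1 - (x - a) / (b - a)))
        + (m₂ * g (a / m₂)) * (1 - (x - a) / (b - a)) ^ 2) (by fun_prop) a b) ?_
  · rw [integral_barycentric_quadratic hab] at hmono
    rw [one_div, inv_mul_le_iff₀ hba]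
    refine hmono.trans_eq ?_
    ring
  · intro x hx
    have hx0 : 0 ≤ x := ha.trans hx.1
    have hb0 : 0 ≤ b := ha.trans hab.le
    have hs : (b - x) / (b - a) = 1 - (x - a) / (b - a) := by
      field_simp
      ring
    have hxt : x = (x - a) / (b - a) * b + (1 - (x - a) / (b - a)) * a := by
      field_simp
      ring
    have ht0 : 0 ≤ (x - a) / (b - a) := div_nonneg (sub_nonneg.2 hx.1) hba.le
    have ht1 : (x - a) / (b - a) ≤ 1 := (div_le_one hba).2 (by linarith [hx.2])
    rw [hs]
    generalize (x - a) / (b - a) = t at hxt ht0 ht1 ⊢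
    have hf' := hf b hb0 (a / m₁) (div_nonneg ha hm₁.1.le) t ⟨ht0, ht1⟩
    have hg' := hg b hb0 (a / m₂) (div_nonneg ha hm₂.1.le) t ⟨ht0, ht1⟩
    have e₁ : t * b + m₁ * (1 - t) * (a / m₁) = x := by
      have := hm₁.1.ne'
      rw [hxt]
      field_simp
    have e₂ : t * b + m₂ * (1 - t) * (a / m₂) = x := by
      have := hm₂.1.ne'
      rw [hxt]
      field_simp
    rw [e₁] at hf'
    rw [e₂] at hg'
    calc f x ^ t * g x ^ (1 - t) ≤ t * f x + (1 - t) * g x :=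
          Real.geom_mean_le_arith_mean2_weighted ht0 (sub_nonneg.2 ht1) (hf0 x hx0) (hg0 x hx0)
            (by ring)
      _ ≤ t * (t * f b + m₁ * (1 - t) * f (a / m₁))
          + (1 - t) * (t * g b + m₂ * (1 - t) * g (a / m₂)) :=
          add_le_add (mul_le_mul_of_nonneg_left hf' ht0)
            (mul_le_mul_of_nonneg_left hg' (sub_nonneg.2 ht1))
      _ = _ := by ring
end

section
/- Let 0 ≤ a < b < ∞ and suppose f, g : [0,∞) → [0,∞) are convex functions such that the function x ↦ f(x)^((x-a)/(b-a)) · g(x)^((b-x)/(b-a)) is integrable on [a,b]. Then (1/(b-a)) ∫_a^b f(x)^((x-a)/(b-a)) g(x)^((b-x)/(b-a)) dx ≤ (1/3)[f(b) + g(a)] + (1/6)[g(b) + f(a)]. -/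
/-- The integral over `[a, b]` of a quadratic form in the barycentric coordinates of `x`. -/
theorem integral_quadratic_barycentric {a b : ℝ} (hab : a < b) (p q r : ℝ) :
    ∫ x in a..b, (p * ((x - a) / (b - a)) ^ 2
        + q * (((x - a) / (b - a)) * (1 - (x - a) / (b - a)))
        + r * (1 - (x - a) / (b - a)) ^ 2)
      = (b - a) * (p / 3 + q / 6 + r / 3) := by
  have hba : b - a ≠ 0 := (sub_pos.2 hab).ne'
  rw [intervalIntegral.integral_eq_sub_of_hasDerivAt
    (f := fun x => (b - a) * (p * (((x - a) / (b - a)) ^ 3 / 3)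
      + q * (((x - a) / (b - a)) ^ 2 / 2 - ((x - a) / (b - a)) ^ 3 / 3)
      - r * ((1 - (x - a) / (b - a)) ^ 3 / 3)))]
  · simp only [div_self hba, sub_self, zero_div]
    ring
  · intro x _
    have ht : HasDerivAt (fun x => (x - a) / (b - a)) (1 / (b - a)) x :=
      ((hasDerivAt_id x).sub_const a).div_const (b - a)
    have h3 := (ht.pow 3).div_const 3
    have h2 := (ht.pow 2).div_const 2
    have hs := ((ht.const_sub 1).pow 3).div_const 3
    refine ((((h3.const_mul p).add ((h2.sub h3).const_mul q)).sub
      (hs.const_mul r)).const_mul (b - a)).congr_deriv ?_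
    generalize (x - a) / (b - a) = t
    push_cast
    field_simp
    ring
  · exact Continuous.intervalIntegrable (by fun_prop) a b

/-- Corollary 1 of the paper: for convex nonnegative `f, g` on `[0,∞)`,
`(1/(b-a)) ∫_a^b f(x)^((x-a)/(b-a)) g(x)^((b-x)/(b-a)) dx
  ≤ (1/3)[f(b) + g(a)] + (1/6)[g(b) + f(a)]`. -/
theorem stmt_1 (a b : ℝ) (f g : ℝ → ℝ)
    (ha : 0 ≤ a) (hab : a < b)
    (hf0 : ∀ x, 0 ≤ x → 0 ≤ f x) (hg0 : ∀ x, 0 ≤ x → 0 ≤ g x)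
    (hf : ∀ x, 0 ≤ x → ∀ y, 0 ≤ y → ∀ t ∈ Set.Icc (0 : ℝ) 1,
      f (t * x + (1 - t) * y) ≤ t * f x + (1 - t) * f y)
    (hg : ∀ x, 0 ≤ x → ∀ y, 0 ≤ y → ∀ t ∈ Set.Icc (0 : ℝ) 1,
      g (t * x + (1 - t) * y) ≤ t * g x + (1 - t) * g y)
    (hint : IntervalIntegrable
      (fun x => f x ^ ((x - a) / (b - a)) * g x ^ ((b - x) / (b - a)))
      MeasureTheory.volume a b) :
    (1 / (b - a)) * ∫ x in a..b, f x ^ ((x - a) / (b - a)) * g x ^ ((b - x) / (b - a))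
      ≤ (1 / 3) * (f b + g a) + (1 / 6) * (g b + f a) := by
  have hba : 0 < b - a := sub_pos.2 hab
  have hb : 0 ≤ b := ha.trans hab.le
  have hmono := intervalIntegral.integral_mono_on
    (g := fun x => f b * ((x - a) / (b - a)) ^ 2
        + (f a + g b) * (((x - a) / (b - a)) * (1 - (x - a) / (b - a)))
        + g a * (1 - (x - a) / (b - a)) ^ 2)
    hab.le hint (Continuous.intervalIntegrable (by fun_prop) a b) fun x hx => by
      have hs : (b - x) / (b - a) = 1 - (x - a) / (b - a) := by
        field_simp
        ring
      have hxt : x = (x - a) / (b - a) * b + (1 - (x - a) / (b - a)) * a := by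
        field_simp
        ring
      have ht0 : 0 ≤ (x - a) / (b - a) := div_nonneg (sub_nonneg.2 hx.1) hba.le
      have ht1 : 0 ≤ 1 - (x - a) / (b - a) := hs ▸ div_nonneg (sub_nonneg.2 hx.2) hba.le
      have hx0 : 0 ≤ x := ha.trans hx.1
      rw [hs]
      have ham := Real.geom_mean_le_arith_mean2_weighted ht0 ht1 (hf0 x hx0) (hg0 x hx0)
        (add_sub_cancel _ _)
      have hfx := hf b hb a ha _ ⟨ht0, sub_nonneg.1 ht1⟩
      have hgx := hg b hb a ha _ ⟨ht0, sub_nonneg.1 ht1⟩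
      rw [← hxt] at hfx hgx
      linarith [mul_le_mul_of_nonneg_left hfx ht0, mul_le_mul_of_nonneg_left hgx ht1]
  rw [integral_quadratic_barycentric hab] at hmono
  rw [one_div, inv_mul_le_iff₀ hba]
  linarith
end

section
/- Let 0 ≤ a < b < ∞ and suppose f, g : [0,∞) → ℝ are convex functions that are monotone increasing on [a,b], with f, g and f·g integrable on [a,b]. Then (g(a)/(b-a)²)[∫_a^b (x-a) f(x) dx + ∫_a^b (b-x) f(x) dx] + (f(a)/(b-a)²)[∫_a^b (x-a) g(x) dx + ∫_a^b (b-x) g(x) dx] ≤ (1/(b-a))∫_a^b f(x) g(x) dx + (1/3) M(a,b) + (1/6) N(a,b), where M(a,b) = f(a)g(a) + f(b)g(b) and N(a,b) = f(a)g(b) + f(b)g(a). -/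
/-- Corollary 3 of the paper: the case of increasing convex functions. -/
theorem stmt_4 (a b : ℝ) (f g : ℝ → ℝ)
    (ha : 0 ≤ a) (hab : a < b)
    (hf0 : ∀ x, 0 ≤ x → 0 ≤ f x) (hg0 : ∀ x, 0 ≤ x → 0 ≤ g x)
    (hf : ∀ x, 0 ≤ x → ∀ y, 0 ≤ y → ∀ t ∈ Set.Icc (0 : ℝ) 1,
      f (t * x + (1 - t) * y) ≤ t * f x + (1 - t) * f y)
    (hg : ∀ x, 0 ≤ x → ∀ y, 0 ≤ y → ∀ t ∈ Set.Icc (0 : ℝ) 1,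
      g (t * x + (1 - t) * y) ≤ t * g x + (1 - t) * g y)
    (hfmono : MonotoneOn f (Set.Icc a b)) (hgmono : MonotoneOn g (Set.Icc a b))
    (hfint : IntervalIntegrable f MeasureTheory.volume a b)
    (hgint : IntervalIntegrable g MeasureTheory.volume a b)
    (hfgint : IntervalIntegrable (fun x => f x * g x) MeasureTheory.volume a b) :
    (g a / (b - a) ^ 2) * ((∫ x in a..b, (x - a) * f x) + ∫ x in a..b, (b - x) * f x)
      + (f a / (b - a) ^ 2) * ((∫ x in a..b, (x - a) * g x) + ∫ x in a..b, (b - x) * g x)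
      ≤ (1 / (b - a)) * ∫ x in a..b, f x * g x
        + (1 / 3) * (f a * g a + f b * g b)
        + (1 / 6) * (f a * g b + f b * g a) := by
  have weights_sum : ∀ h : ℝ → ℝ, IntervalIntegrable h MeasureTheory.volume a b →
      (∫ x in a..b, (x - a) * h x) + ∫ x in a..b, (b - x) * h x
        = (b - a) * ∫ x in a..b, h x := by
    intro h hh
    rw [← intervalIntegral.integral_add (hh.continuousOn_mul (by fun_prop))
      (hh.continuousOn_mul (by fun_prop)), ← intervalIntegral.integral_const_mul]
    congr 1
    ext x
    ring
  have hpos : 0 < b - a := sub_pos.mpr hab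
  have ha_mem : a ∈ Set.Icc a b := Set.left_mem_Icc.mpr hab.le
  have hb_mem : b ∈ Set.Icc a b := Set.right_mem_Icc.mpr hab.le
  have hfab := hfmono ha_mem hb_mem hab.le
  have hgab := hgmono ha_mem hb_mem hab.le
  have hfa := hf0 a ha
  have hga := hg0 a ha
  have hle : (∫ x in a..b, (g a * f x + f a * g x)) ≤
      ∫ x in a..b, (f x * g x + (1 / 3) * (f a * g a + f b * g b)
        + (1 / 6) * (f a * g b + f b * g a)) := by
    apply intervalIntegral.integral_mono_on hab.le
    · exact (hfint.const_mul _).add (hgint.const_mul _)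
    · exact (hfgint.add intervalIntegrable_const).add intervalIntegrable_const
    · intro x hx
      have hfx := hfmono ha_mem hx hx.1
      have hgx := hgmono ha_mem hx hx.1
      nlinarith [mul_nonneg (sub_nonneg.mpr hfx) (sub_nonneg.mpr hgx),
        mul_le_mul_of_nonneg_left hgab hfa, mul_le_mul_of_nonneg_right hfab hga,
        mul_le_mul hfab hgab hga (hfa.trans hfab)]
  rw [intervalIntegral.integral_add (hfint.const_mul _) (hgint.const_mul _),
    intervalIntegral.integral_const_mul, intervalIntegral.integral_const_mul] at hle
  rw [weights_sum f hfint, weights_sum g hgint]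
  calc _ = (1 / (b - a)) * (g a * (∫ x in a..b, f x) + f a * ∫ x in a..b, g x) := by
        field_simp
    _ ≤ _ := mul_le_mul_of_nonneg_left hle (by positivity)
end

section
/- Let 0 ≤ a < b < ∞, let m₁, m₂ ∈ (0,1], and let p ≥ 1. Suppose f, g : [0,∞) → (0,∞) are m₁-convex and m₂-convex respectively, f^p and g^p are integrable on [a,b], and there exist constants 0 < m ≤ M such that m ≤ f(x)/g(x) ≤ M for all x ∈ [a,b]. Then (1/c)[(∫_a^b f(x)^p dx)^(1/p) + (∫_a^b g(x)^p dx)^(1/p)] ≤ (2^(p-1)(b-a)/(p+1))^(1/p) · ([f(b) + g(b)]^p + [m₁ f(a/m₁) + m₂ g(a/m₂)]^p)^(1/p), where c = (M(m+1) + (M+1))/((m+1)(M+1)). -/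
/-- The `p`-th power of an affine interpolation, split by the power-mean inequality. -/
lemma add_mul_rpow_le {A B t p : ℝ} (hA : 0 ≤ A) (hB : 0 ≤ B) (ht : 0 ≤ t) (ht' : t ≤ 1)
    (hp : 1 ≤ p) :
    (t * B + (1 - t) * A) ^ p ≤ 2 ^ (p - 1) * (t ^ p * B ^ p + (1 - t) ^ p * A ^ p) := by
  have h1 : 0 ≤ 1 - t := sub_nonneg.2 ht'
  rw [← Real.mul_rpow ht hB, ← Real.mul_rpow h1 hA]
  exact_mod_cast NNReal.rpow_add_le_mul_rpow_add_rpow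
    ⟨t * B, mul_nonneg ht hB⟩ ⟨(1 - t) * A, mul_nonneg h1 hA⟩ hp

lemma integral_rpow_interpolation {a b p : ℝ} (hab : a < b) (hp : 0 ≤ p) (A B : ℝ) :
    ∫ x in a..b, 2 ^ (p - 1) * ((x / (b - a) - a / (b - a)) ^ p * B +
      (b / (b - a) - x / (b - a)) ^ p * A) = 2 ^ (p - 1) * (b - a) / (p + 1) * (B + A) := by
  have hd : b - a ≠ 0 := (sub_pos.2 hab).ne'
  have hone : b / (b - a) - a / (b - a) = 1 := by rw [← sub_div, div_self hd]
  have hbase : ∫ x in (0 : ℝ)..1, x ^ p = 1 / (p + 1) := by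
    rw [integral_rpow (Or.inl (by linarith)), Real.one_rpow,
      Real.zero_rpow (by linarith), sub_zero]
  have h1 : Continuous fun x : ℝ => (x / (b - a) - a / (b - a)) ^ p :=
    Continuous.rpow_const (by fun_prop) fun _ => Or.inr hp
  have h2 : Continuous fun x : ℝ => (b / (b - a) - x / (b - a)) ^ p :=
    Continuous.rpow_const (by fun_prop) fun _ => Or.inr hp
  rw [intervalIntegral.integral_const_mul, intervalIntegral.integral_add
    ((h1.intervalIntegrable _ _).mul_const _)
    ((h2.intervalIntegrable _ _).mul_const _),
    intervalIntegral.integral_mul_const, intervalIntegral.integral_mul_const,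
    intervalIntegral.integral_comp_div_sub (fun x => x ^ p) hd,
    intervalIntegral.integral_comp_sub_div (fun x => x ^ p) hd,
    sub_self, sub_self, hone, hbase]
  simp only [smul_eq_mul]
  ring

/-- If `u ≤ k * w` with `w ^ p ≤ H`, then the `L^p` norm of `u` is at most `k * (∫ H) ^ (1 / p)`. -/
lemma rpow_integral_le_mul {a b p k : ℝ} {u w H : ℝ → ℝ} (hab : a ≤ b) (hp : 0 < p) (hk : 0 ≤ k)
    (hu : ∀ x ∈ Set.Icc a b, 0 ≤ u x) (hw : ∀ x ∈ Set.Icc a b, 0 ≤ w x)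
    (huw : ∀ x ∈ Set.Icc a b, u x ≤ k * w x) (hwH : ∀ x ∈ Set.Icc a b, w x ^ p ≤ H x)
    (hint : IntervalIntegrable (fun x => u x ^ p) MeasureTheory.volume a b)
    (hH : IntervalIntegrable H MeasureTheory.volume a b) :
    (∫ x in a..b, u x ^ p) ^ (1 / p) ≤ k * (∫ x in a..b, H x) ^ (1 / p) := by
  have h0 : 0 ≤ ∫ x in a..b, u x ^ p :=
    intervalIntegral.integral_nonneg hab fun x hx => Real.rpow_nonneg (hu x hx) p
  have hH0 : 0 ≤ ∫ x in a..b, H x :=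
    intervalIntegral.integral_nonneg hab fun x hx =>
      (Real.rpow_nonneg (hw x hx) p).trans (hwH x hx)
  have hle : ∫ x in a..b, u x ^ p ≤ k ^ p * ∫ x in a..b, H x := by
    rw [← intervalIntegral.integral_const_mul]
    refine intervalIntegral.integral_mono_on hab hint (hH.const_mul _) fun x hx => ?_
    calc u x ^ p ≤ (k * w x) ^ p := Real.rpow_le_rpow (hu x hx) (huw x hx) hp.le
      _ = k ^ p * w x ^ p := Real.mul_rpow hk (hw x hx)
      _ ≤ k ^ p * H x := mul_le_mul_of_nonneg_left (hwH x hx) (Real.rpow_nonneg hk p)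
  calc (∫ x in a..b, u x ^ p) ^ (1 / p)
      ≤ (k ^ p * ∫ x in a..b, H x) ^ (1 / p) :=
        Real.rpow_le_rpow h0 hle (one_div_pos.2 hp).le
    _ = k * (∫ x in a..b, H x) ^ (1 / p) := by
        rw [Real.mul_rpow (Real.rpow_nonneg hk p) hH0, ← Real.rpow_mul hk,
          mul_one_div_cancel hp.ne', Real.rpow_one]


/-- Theorem 5 of the paper: a reverse-Minkowski type inequality for
`m₁`-convex `f` and `m₂`-convex `g` whose ratio is bounded. -/
theorem stmt_5 (a b m₁ m₂ p m M : ℝ) (f g : ℝ → ℝ)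
    (ha : 0 ≤ a) (hab : a < b)
    (hm₁ : m₁ ∈ Set.Ioc (0 : ℝ) 1) (hm₂ : m₂ ∈ Set.Ioc (0 : ℝ) 1)
    (hp : 1 ≤ p)
    (hfpos : ∀ x, 0 ≤ x → 0 < f x) (hgpos : ∀ x, 0 ≤ x → 0 < g x)
    (hf : ∀ x, 0 ≤ x → ∀ y, 0 ≤ y → ∀ t ∈ Set.Icc (0 : ℝ) 1,
      f (t * x + m₁ * (1 - t) * y) ≤ t * f x + m₁ * (1 - t) * f y)
    (hg : ∀ x, 0 ≤ x → ∀ y, 0 ≤ y → ∀ t ∈ Set.Icc (0 : ℝ) 1,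
      g (t * x + m₂ * (1 - t) * y) ≤ t * g x + m₂ * (1 - t) * g y)
    (hfpint : IntervalIntegrable (fun x => f x ^ p) MeasureTheory.volume a b)
    (hgpint : IntervalIntegrable (fun x => g x ^ p) MeasureTheory.volume a b)
    (hm : 0 < m) (hmM : m ≤ M)
    (hratio : ∀ x ∈ Set.Icc a b, m ≤ f x / g x ∧ f x / g x ≤ M) :
    (1 / ((M * (m + 1) + (M + 1)) / ((m + 1) * (M + 1)))) *
        ((∫ x in a..b, f x ^ p) ^ (1 / p) + (∫ x in a..b, g x ^ p) ^ (1 / p))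
      ≤ (2 ^ (p - 1) * (b - a) / (p + 1)) ^ (1 / p) *
          ((f b + g b) ^ p + (m₁ * f (a / m₁) + m₂ * g (a / m₂)) ^ p) ^ (1 / p) := by
  have hp0 : 0 < p := by linarith
  have hd : 0 < b - a := sub_pos.2 hab
  have hb : 0 ≤ b := ha.trans hab.le
  have hM : 0 < M := hm.trans_le hmM
  obtain ⟨hm₁0, -⟩ := hm₁
  obtain ⟨hm₂0, -⟩ := hm₂
  have ha₁ : 0 ≤ a / m₁ := div_nonneg ha hm₁0.le
  have ha₂ : 0 ≤ a / m₂ := div_nonneg ha hm₂0.le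
  set B := f b + g b with hB
  set A := m₁ * f (a / m₁) + m₂ * g (a / m₂) with hA
  have hB0 : 0 ≤ B := (add_pos (hfpos b hb) (hgpos b hb)).le
  have hA0 : 0 ≤ A :=
    (add_pos (mul_pos hm₁0 (hfpos _ ha₁)) (mul_pos hm₂0 (hgpos _ ha₂))).le
  have hBA : 0 ≤ B ^ p + A ^ p := add_nonneg (Real.rpow_nonneg hB0 p) (Real.rpow_nonneg hA0 p)
  let H : ℝ → ℝ := fun x => 2 ^ (p - 1) * ((x / (b - a) - a / (b - a)) ^ p * B ^ p +
      (b / (b - a) - x / (b - a)) ^ p * A ^ p)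
  have hHcont : Continuous H :=
    continuous_const.mul
      (((Continuous.rpow_const (by fun_prop) fun _ => Or.inr hp0.le).mul continuous_const).add
        ((Continuous.rpow_const (by fun_prop) fun _ => Or.inr hp0.le).mul continuous_const))
  have hHint := hHcont.intervalIntegrable (μ := MeasureTheory.volume) a b
  have hfx : ∀ x ∈ Set.Icc a b, 0 < f x := fun x hx => hfpos x (ha.trans hx.1)
  have hgx : ∀ x ∈ Set.Icc a b, 0 < g x := fun x hx => hgpos x (ha.trans hx.1)
  have hsum : ∀ x ∈ Set.Icc a b, 0 ≤ f x + g x := fun x hx => (add_pos (hfx x hx) (hgx x hx)).le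
  have hbound : ∀ x ∈ Set.Icc a b, (f x + g x) ^ p ≤ H x := by
    intro x hx
    obtain ⟨t, ht⟩ : ∃ t, t = (x - a) / (b - a) := ⟨_, rfl⟩
    have ht0 : 0 ≤ t := ht ▸ div_nonneg (sub_nonneg.2 hx.1) hd.le
    have ht1 : t ≤ 1 := by rw [ht, div_le_one hd]; linarith [hx.2]
    have hxt : t * b + (1 - t) * a = x := by rw [ht]; field_simp; ring
    have hfc := hf b hb (a / m₁) ha₁ t ⟨ht0, ht1⟩
    have hgc := hg b hb (a / m₂) ha₂ t ⟨ht0, ht1⟩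
    rw [show t * b + m₁ * (1 - t) * (a / m₁) = x by rw [← hxt]; field_simp] at hfc
    rw [show t * b + m₂ * (1 - t) * (a / m₂) = x by rw [← hxt]; field_simp] at hgc
    have hle : f x + g x ≤ t * B + (1 - t) * A := by
      rw [hA, hB]; linarith
    have e1 : x / (b - a) - a / (b - a) = t := by rw [ht, sub_div]
    have e2 : b / (b - a) - x / (b - a) = 1 - t := by rw [ht]; field_simp; ring
    simp only [H, e1, e2]
    exact (Real.rpow_le_rpow (hsum x hx) hle hp0.le).trans
      (add_mul_rpow_le hA0 hB0 ht0 ht1 hp)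
  have hfN := rpow_integral_le_mul (k := M / (M + 1)) hab.le hp0 (by positivity)
    (fun x hx => (hfx x hx).le) hsum
    (fun x hx => by
      have h := (div_le_iff₀ (hgx x hx)).1 (hratio x hx).2
      rw [div_mul_eq_mul_div, le_div_iff₀ (by linarith)]
      linarith)
    hbound hfpint hHint
  have hgN := rpow_integral_le_mul (k := 1 / (m + 1)) hab.le hp0 (by positivity)
    (fun x hx => (hgx x hx).le) hsum
    (fun x hx => by
      have h := (le_div_iff₀ (hgx x hx)).1 (hratio x hx).1
      rw [div_mul_eq_mul_div, le_div_iff₀ (by linarith)]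
      linarith)
    hbound hgpint hHint
  have hHval : ∫ x in a..b, H x = 2 ^ (p - 1) * (b - a) / (p + 1) * (B ^ p + A ^ p) :=
    integral_rpow_interpolation hab hp0.le _ _
  have hc : (M * (m + 1) + (M + 1)) / ((m + 1) * (M + 1)) = M / (M + 1) + 1 / (m + 1) := by
    field_simp
  have hc0 : 0 < M / (M + 1) + 1 / (m + 1) := by positivity
  rw [← Real.mul_rpow (by positivity) hBA, ← hHval, hc, one_div_mul_eq_div, div_le_iff₀' hc0,
    add_mul]
  exact add_le_add hfN hgN
end

section
/- Let 0 ≤ a < b < ∞. Suppose f, g : [0,∞) → (0,∞) are convex functions, integrable on [a,b], and there exist constants 0 < m ≤ M such that m ≤ f(x)/g(x) ≤ M for all x ∈ [a,b]. Then ∫_a^b [f(x) + g(x)] dx ≤ (c(b-a)/2)·[(f(b) + g(b)) + (f(a) + g(a))], where c = (M(m+1) + (M+1))/((m+1)(M+1)). -/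
/-- The right-hand Hermite–Hadamard inequality. -/
theorem ConvexOn.intervalIntegral_le_trapezoid {a b : ℝ} {h : ℝ → ℝ} (hab : a < b)
    (hconv : ConvexOn ℝ (Set.Icc a b) h)
    (hint : IntervalIntegrable h MeasureTheory.volume a b) :
    ∫ x in a..b, h x ≤ (b - a) / 2 * (h a + h b) := by
  have hba : 0 < b - a := sub_pos.mpr hab
  have chord_int : ∫ x in a..b, (h a + (h b - h a) / (b - a) * (x - a)) =
      (b - a) / 2 * (h a + h b) := by
    rw [intervalIntegral.integral_add (by simp)
      (Continuous.intervalIntegrable (by fun_prop) _ _),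
      intervalIntegral.integral_const_mul, intervalIntegral.integral_sub (by simp) (by simp)]
    simp only [intervalIntegral.integral_const, integral_id, smul_eq_mul]
    field_simp
    ring
  rw [← chord_int]
  refine intervalIntegral.integral_mono_on hab.le hint
    (Continuous.intervalIntegrable (by fun_prop) _ _) fun x hx => ?_
  have key := hconv.2 (Set.left_mem_Icc.mpr hab.le) (Set.right_mem_Icc.mpr hab.le)
    (div_nonneg (sub_nonneg.mpr hx.2) hba.le) (div_nonneg (sub_nonneg.mpr hx.1) hba.le)
    (by field_simp; ring)
  simp only [smul_eq_mul] at key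
  have hx_eq : (b - x) / (b - a) * a + (x - a) / (b - a) * b = x := by
    field_simp
    ring
  rw [hx_eq] at key
  refine key.trans_eq ?_
  field_simp
  ring

/-- Corollary 4 of the paper: the case `m₁ = m₂ = 1`, `p → 1` of Theorem 5. -/
theorem stmt_6 (a b m M : ℝ) (f g : ℝ → ℝ)
    (ha : 0 ≤ a) (hab : a < b)
    (hfpos : ∀ x, 0 ≤ x → 0 < f x) (hgpos : ∀ x, 0 ≤ x → 0 < g x)
    (hf : ∀ x, 0 ≤ x → ∀ y, 0 ≤ y → ∀ t ∈ Set.Icc (0 : ℝ) 1,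
      f (t * x + (1 - t) * y) ≤ t * f x + (1 - t) * f y)
    (hg : ∀ x, 0 ≤ x → ∀ y, 0 ≤ y → ∀ t ∈ Set.Icc (0 : ℝ) 1,
      g (t * x + (1 - t) * y) ≤ t * g x + (1 - t) * g y)
    (hfint : IntervalIntegrable f MeasureTheory.volume a b)
    (hgint : IntervalIntegrable g MeasureTheory.volume a b)
    (hm : 0 < m) (hmM : m ≤ M)
    (hratio : ∀ x ∈ Set.Icc a b, m ≤ f x / g x ∧ f x / g x ≤ M) :
    (∫ x in a..b, f x + g x)
      ≤ ((M * (m + 1) + (M + 1)) / ((m + 1) * (M + 1))) * (b - a) / 2 *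
          ((f b + g b) + (f a + g a)) := by
  have hconv : ConvexOn ℝ (Set.Icc a b) fun x => f x + g x := by
    refine ⟨convex_Icc a b, fun x hx y hy s t hs ht hst => ?_⟩
    obtain rfl : t = 1 - s := by linarith
    have hs' : s ∈ Set.Icc (0 : ℝ) 1 := ⟨hs, by linarith⟩
    have hfs := hf x (ha.trans hx.1) y (ha.trans hy.1) s hs'
    have hgs := hg x (ha.trans hx.1) y (ha.trans hy.1) s hs'
    simp only [smul_eq_mul]
    linarith
  have hc : 1 ≤ (M * (m + 1) + (M + 1)) / ((m + 1) * (M + 1)) := by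
    rw [one_le_div (by nlinarith)]
    linarith
  have hb : 0 ≤ b := ha.trans hab.le
  have hpos : 0 ≤ (b - a) / 2 * ((f a + g a) + (f b + g b)) :=
    mul_nonneg (by linarith)
      (by linarith [hfpos a ha, hgpos a ha, hfpos b hb, hgpos b hb])
  calc ∫ x in a..b, f x + g x
      ≤ (b - a) / 2 * ((f a + g a) + (f b + g b)) :=
        hconv.intervalIntegral_le_trapezoid hab (hfint.add hgint)
    _ ≤ (M * (m + 1) + (M + 1)) / ((m + 1) * (M + 1)) *
          ((b - a) / 2 * ((f a + g a) + (f b + g b))) := le_mul_of_one_le_left hpos hc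
    _ = _ := by ring
end

section
/- Let 0 ≤ a < b < ∞ and let s₁, s₂ ∈ (0,1]. Suppose f, g : [0,∞) → [0,∞) are s₁-convex and s₂-convex in the second sense respectively, and that the function x ↦ f(x)^((x-a)/(b-a)) · g(x)^((b-x)/(b-a)) is integrable on [a,b]. Then (1/(b-a)) ∫_a^b f(x)^((x-a)/(b-a)) g(x)^((b-x)/(b-a)) dx ≤ (1/(s₁+2)) f(b) + B(2, s₁+1) f(a) + B(s₂+1, 2) g(b) + (1/(s₂+2)) g(a), where B denotes the Euler Beta function B(x,y) = ∫_0^1 t^(x-1)(1-t)^(y-1) dt. -/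
open MeasureTheory

/-- The Euler Beta function `B(x,y) = ∫_0^1 t^(x-1) (1-t)^(y-1) dt`. -/
noncomputable def eulerBeta (x y : ℝ) : ℝ :=
  ∫ t in (0 : ℝ)..1, t ^ (x - 1) * (1 - t) ^ (y - 1)

/-- Young's inequality combined with the `s`-convexity bounds at `t • b + (1 - t) • a`. -/
theorem rpow_mul_rpow_le_of_sConvex_bounds {u v p q p' q' s₁ s₂ t : ℝ} (hu : 0 ≤ u) (hv : 0 ≤ v)
    (ht : t ∈ Set.Icc (0 : ℝ) 1) (hup : u ≤ t ^ s₁ * p + (1 - t) ^ s₁ * q)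
    (hvp : v ≤ t ^ s₂ * p' + (1 - t) ^ s₂ * q') :
    u ^ t * v ^ (1 - t) ≤ t * t ^ s₁ * p + t * (1 - t) ^ s₁ * q
      + t ^ s₂ * (1 - t) * p' + (1 - t) * (1 - t) ^ s₂ * q' := by
  have ht' : 0 ≤ 1 - t := sub_nonneg.2 ht.2
  calc u ^ t * v ^ (1 - t) ≤ t * u + (1 - t) * v :=
        Real.geom_mean_le_arith_mean2_weighted ht.1 ht' hu hv (by ring)
    _ ≤ t * (t ^ s₁ * p + (1 - t) ^ s₁ * q) + (1 - t) * (t ^ s₂ * p' + (1 - t) ^ s₂ * q') := by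
        gcongr
        exact ht.1
    _ = _ := by ring

theorem integral_mul_rpow_zero_one {s : ℝ} (hs : 0 < s) :
    ∫ t in (0 : ℝ)..1, t * t ^ s = 1 / (s + 2) := by
  have h : ∀ t ∈ Set.uIcc (0 : ℝ) 1, t * t ^ s = t ^ (s + 1) := fun t ht => by
    rw [Set.uIcc_of_le zero_le_one] at ht
    rw [Real.rpow_add_one' ht.1 (by linarith), mul_comm]
  rw [intervalIntegral.integral_congr h, integral_rpow (Or.inl (by linarith)), Real.one_rpow,
    Real.zero_rpow (by linarith)]
  ring

theorem integral_one_sub_mul_rpow_zero_one {s : ℝ} (hs : 0 < s) :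
    ∫ t in (0 : ℝ)..1, (1 - t) * (1 - t) ^ s = 1 / (s + 2) := by
  rw [intervalIntegral.integral_comp_sub_left (fun t : ℝ => t * t ^ s), sub_self, sub_zero,
    integral_mul_rpow_zero_one hs]

theorem eulerBeta_two_left (s : ℝ) :
    eulerBeta 2 (s + 1) = ∫ t in (0 : ℝ)..1, t * (1 - t) ^ s := by
  norm_num [eulerBeta]

theorem eulerBeta_two_right (s : ℝ) :
    eulerBeta (s + 1) 2 = ∫ t in (0 : ℝ)..1, t ^ s * (1 - t) := by
  norm_num [eulerBeta]

theorem integral_sConvex_majorant {s₁ s₂ : ℝ} (hs₁ : 0 < s₁) (hs₂ : 0 < s₂) (p q p' q' : ℝ) :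
    ∫ t in (0 : ℝ)..1, (t * t ^ s₁ * p + t * (1 - t) ^ s₁ * q
      + t ^ s₂ * (1 - t) * p' + (1 - t) * (1 - t) ^ s₂ * q')
      = (1 / (s₁ + 2)) * p + eulerBeta 2 (s₁ + 1) * q
        + eulerBeta (s₂ + 1) 2 * p' + (1 / (s₂ + 2)) * q' := by
  have c₁ := Real.continuous_rpow_const hs₁.le
  have c₂ := Real.continuous_rpow_const hs₂.le
  have d₁ : Continuous fun t : ℝ => (1 - t) ^ s₁ := c₁.comp (by fun_prop)
  have d₂ : Continuous fun t : ℝ => (1 - t) ^ s₂ := c₂.comp (by fun_prop)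
  rw [intervalIntegral.integral_add, intervalIntegral.integral_add, intervalIntegral.integral_add]
  · simp only [intervalIntegral.integral_mul_const]
    rw [integral_mul_rpow_zero_one hs₁, integral_one_sub_mul_rpow_zero_one hs₂,
      eulerBeta_two_left, eulerBeta_two_right]
  all_goals exact Continuous.intervalIntegrable (by fun_prop) _ _

/-- Theorem 6 of the paper: for `s₁`-convex `f` and `s₂`-convex `g` in the
second sense,
`(1/(b-a)) ∫_a^b f(x)^((x-a)/(b-a)) g(x)^((b-x)/(b-a)) dx
  ≤ f(b)/(s₁+2) + B(2,s₁+1) f(a) + B(s₂+1,2) g(b) + g(a)/(s₂+2)`. -/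
theorem stmt_7 (a b s₁ s₂ : ℝ) (f g : ℝ → ℝ)
    (ha : 0 ≤ a) (hab : a < b)
    (hs₁ : s₁ ∈ Set.Ioc (0 : ℝ) 1) (hs₂ : s₂ ∈ Set.Ioc (0 : ℝ) 1)
    (hf0 : ∀ x, 0 ≤ x → 0 ≤ f x) (hg0 : ∀ x, 0 ≤ x → 0 ≤ g x)
    (hf : ∀ x, 0 ≤ x → ∀ y, 0 ≤ y → ∀ t ∈ Set.Icc (0 : ℝ) 1,
      f (t * x + (1 - t) * y) ≤ t ^ s₁ * f x + (1 - t) ^ s₁ * f y)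
    (hg : ∀ x, 0 ≤ x → ∀ y, 0 ≤ y → ∀ t ∈ Set.Icc (0 : ℝ) 1,
      g (t * x + (1 - t) * y) ≤ t ^ s₂ * g x + (1 - t) ^ s₂ * g y)
    (hint : IntervalIntegrable
      (fun x => f x ^ ((x - a) / (b - a)) * g x ^ ((b - x) / (b - a)))
      MeasureTheory.volume a b) :
    (1 / (b - a)) * ∫ x in a..b, f x ^ ((x - a) / (b - a)) * g x ^ ((b - x) / (b - a))
      ≤ (1 / (s₁ + 2)) * f b + eulerBeta 2 (s₁ + 1) * f a
        + eulerBeta (s₂ + 1) 2 * g b + (1 / (s₂ + 2)) * g a := by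
  have hba : 0 < b - a := sub_pos.2 hab
  set h : ℝ → ℝ := fun t => t * t ^ s₁ * f b + t * (1 - t) ^ s₁ * f a
    + t ^ s₂ * (1 - t) * g b + (1 - t) * (1 - t) ^ s₂ * g a
  have h_cont : Continuous h := by
    have c₁ := Real.continuous_rpow_const hs₁.1.le
    have c₂ := Real.continuous_rpow_const hs₂.1.le
    have d₁ : Continuous fun t : ℝ => (1 - t) ^ s₁ := c₁.comp (by fun_prop)
    have d₂ : Continuous fun t : ℝ => (1 - t) ^ s₂ := c₂.comp (by fun_prop)
    fun_prop
  have h_le : ∀ x ∈ Set.Icc a b,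
      f x ^ ((x - a) / (b - a)) * g x ^ ((b - x) / (b - a)) ≤ h ((x - a) / (b - a)) := by
    intro x hx
    have ht : (x - a) / (b - a) ∈ Set.Icc (0 : ℝ) 1 :=
      ⟨div_nonneg (sub_nonneg.2 hx.1) hba.le, (div_le_one hba).2 (by linarith [hx.2])⟩
    have hx_eq : (x - a) / (b - a) * b + (1 - (x - a) / (b - a)) * a = x := by
      field_simp
      ring
    have h_sub : (b - x) / (b - a) = 1 - (x - a) / (b - a) := by
      field_simp
      ring
    have hfx := hf b (by linarith) a ha _ ht
    have hgx := hg b (by linarith) a ha _ ht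
    rw [hx_eq] at hfx hgx
    rw [h_sub]
    have hx0 := ha.trans hx.1
    exact rpow_mul_rpow_le_of_sConvex_bounds (hf0 x hx0) (hg0 x hx0) ht hfx hgx
  have h_int : ∫ x in a..b, h ((x - a) / (b - a)) = (b - a) * ∫ t in (0 : ℝ)..1, h t := by
    rw [intervalIntegral.integral_comp_sub_right (fun x => h (x / (b - a))),
      intervalIntegral.integral_comp_div _ hba.ne', sub_self, zero_div, div_self hba.ne',
      smul_eq_mul]
  calc _ ≤ (1 / (b - a)) * ∫ x in a..b, h ((x - a) / (b - a)) := by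
        gcongr
        exact intervalIntegral.integral_mono_on hab.le hint
          (Continuous.intervalIntegrable (by fun_prop) _ _) h_le
    _ = ∫ t in (0 : ℝ)..1, h t := by
        rw [h_int]
        field_simp
    _ = _ := integral_sConvex_majorant hs₁.1 hs₂.1 _ _ _ _
end

section
/- Let 0 ≤ a < b < ∞ and suppose f, g : [0,∞) → [0,∞) are convex functions such that the function x ↦ f(x)^((x-a)/(b-a)) · g(x)^((b-x)/(b-a)) is integrable on [a,b]. Then (1/(b-a)) ∫_a^b f(x)^((x-a)/(b-a)) g(x)^((b-x)/(b-a)) dx ≤ (1/3)[f(b) + g(a)] + (1/6)[f(a) + g(b)]. -/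
/-- Corollary 5 of the paper: the case `s₁ = s₂ = 1` of Theorem 6, for convex
nonnegative functions `f, g`. -/
theorem stmt_8 (a b : ℝ) (f g : ℝ → ℝ)
    (ha : 0 ≤ a) (hab : a < b)
    (hf0 : ∀ x, 0 ≤ x → 0 ≤ f x) (hg0 : ∀ x, 0 ≤ x → 0 ≤ g x)
    (hf : ∀ x, 0 ≤ x → ∀ y, 0 ≤ y → ∀ t ∈ Set.Icc (0 : ℝ) 1,
      f (t * x + (1 - t) * y) ≤ t * f x + (1 - t) * f y)
    (hg : ∀ x, 0 ≤ x → ∀ y, 0 ≤ y → ∀ t ∈ Set.Icc (0 : ℝ) 1,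
      g (t * x + (1 - t) * y) ≤ t * g x + (1 - t) * g y)
    (hint : IntervalIntegrable
      (fun x => f x ^ ((x - a) / (b - a)) * g x ^ ((b - x) / (b - a)))
      MeasureTheory.volume a b) :
    (1 / (b - a)) * ∫ x in a..b, f x ^ ((x - a) / (b - a)) * g x ^ ((b - x) / (b - a))
      ≤ (1 / 3) * (f b + g a) + (1 / 6) * (f a + g b) := by
  have hba : 0 < b - a := sub_pos.2 hab
  set H : ℝ → ℝ := fun t =>
    (f b - f a - g b + g a) * t ^ 2 + (f a + g b - 2 * g a) * t + g a with hH
  have hbound : ∀ x ∈ Set.Icc a b,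
      f x ^ ((x - a) / (b - a)) * g x ^ ((b - x) / (b - a)) ≤ H (x / (b - a) - a / (b - a)) := by
    rintro x ⟨hax, hxb⟩
    rw [← sub_div]
    have hsub : (b - x) / (b - a) = 1 - (x - a) / (b - a) := by
      field_simp
      ring
    have hx : (x - a) / (b - a) * b + (1 - (x - a) / (b - a)) * a = x := by
      field_simp
      ring
    have ht0 : 0 ≤ (x - a) / (b - a) := div_nonneg (by linarith) hba.le
    have ht1 : (x - a) / (b - a) ≤ 1 := (div_le_one hba).2 (by linarith)
    rw [hsub]
    generalize (x - a) / (b - a) = t at hx ht0 ht1 ⊢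
    have hfx := hf b (ha.trans hab.le) a ha t ⟨ht0, ht1⟩
    have hgx := hg b (ha.trans hab.le) a ha t ⟨ht0, ht1⟩
    rw [hx] at hfx hgx
    calc f x ^ t * g x ^ (1 - t) ≤ t * f x + (1 - t) * g x :=
          Real.geom_mean_le_arith_mean2_weighted ht0 (sub_nonneg.2 ht1)
            (hf0 x (ha.trans hax)) (hg0 x (ha.trans hax)) (by ring)
      _ ≤ t * (t * f b + (1 - t) * f a) + (1 - t) * (t * g b + (1 - t) * g a) :=
          add_le_add (mul_le_mul_of_nonneg_left hfx ht0)
            (mul_le_mul_of_nonneg_left hgx (sub_nonneg.2 ht1))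
      _ = H t := by simp only [hH]; ring
  have hHcont : Continuous H := by fun_prop
  have hmono := intervalIntegral.integral_mono_on hab.le hint
    (Continuous.intervalIntegrable (by fun_prop) a b) hbound
  have hH01 : ∫ t in (0 : ℝ)..1, H t = 1 / 3 * (f b + g a) + 1 / 6 * (f a + g b) := by
    simp only [hH]
    rw [intervalIntegral.integral_add (Continuous.intervalIntegrable (by fun_prop) _ _)
        (Continuous.intervalIntegrable (by fun_prop) _ _),
      intervalIntegral.integral_add (Continuous.intervalIntegrable (by fun_prop) _ _)
        (Continuous.intervalIntegrable (by fun_prop) _ _),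
      intervalIntegral.integral_const_mul, intervalIntegral.integral_const_mul,
      integral_pow, integral_id, intervalIntegral.integral_const]
    norm_num
    ring
  rw [intervalIntegral.integral_comp_div_sub H hba.ne', sub_self, ← sub_div,
    div_self hba.ne', hH01, smul_eq_mul] at hmono
  rw [one_div_mul_eq_div, div_le_iff₀' hba]
  exact hmono
end

section
/- Let 0 ≤ a < b < ∞, let s ∈ (0,1], and let α, β > 0 with α + β = 1. Suppose f, g : [0,∞) → [0,∞) are both s-convex in the second sense, and that the function x ↦ f(x)^α · g(x)^β is integrable on [a,b]. Then (1/(b-a)) ∫_a^b f(x)^α g(x)^β dx ≤ (1/(s+1))·[α(f(a) + f(b)) + β(g(a) + g(b))]. -/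
/-- The integral over `[a, b]` of the `s`-th power of the affine coordinate vanishing at `a`. -/
lemma integral_sub_left_div_rpow {a b s : ℝ} (hab : a < b) (hs : 0 < s) :
    ∫ x in a..b, ((x - a) / (b - a)) ^ s = (b - a) / (s + 1) := by
  have hba : b - a ≠ 0 := (sub_pos.2 hab).ne'
  simp only [sub_div _ a]
  rw [intervalIntegral.integral_comp_div_sub (fun u : ℝ => u ^ s) hba, sub_self, ← sub_div,
    div_self hba, integral_rpow (Or.inl (by linarith)), Real.one_rpow,
    Real.zero_rpow (by linarith)]
  simp [div_eq_mul_inv, sub_mul]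

/-- The integral over `[a, b]` of the `s`-th power of the affine coordinate vanishing at `b`. -/
lemma integral_sub_right_div_rpow {a b s : ℝ} (hab : a < b) (hs : 0 < s) :
    ∫ x in a..b, ((b - x) / (b - a)) ^ s = (b - a) / (s + 1) := by
  have hba : b - a ≠ 0 := (sub_pos.2 hab).ne'
  simp only [sub_div b]
  rw [intervalIntegral.integral_comp_sub_div (fun u : ℝ => u ^ s) hba, sub_self, ← sub_div,
    div_self hba, integral_rpow (Or.inl (by linarith)), Real.one_rpow,
    Real.zero_rpow (by linarith)]
  simp [div_eq_mul_inv, sub_mul]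

/-- An `s`-convex function on `[0, ∞)` is bounded on `[a, b]` by the `s`-power interpolation of its
endpoint values. -/
lemma le_rpow_interpolation {a b s x : ℝ} {f : ℝ → ℝ} (ha : 0 ≤ a) (hab : a < b)
    (hx : x ∈ Set.Icc a b)
    (hf : ∀ x, 0 ≤ x → ∀ y, 0 ≤ y → ∀ t ∈ Set.Icc (0 : ℝ) 1,
      f (t * x + (1 - t) * y) ≤ t ^ s * f x + (1 - t) ^ s * f y) :
    f x ≤ ((b - x) / (b - a)) ^ s * f a + ((x - a) / (b - a)) ^ s * f b := by
  have hba : 0 < b - a := sub_pos.2 hab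
  have h := hf a ha b (ha.trans hab.le) ((b - x) / (b - a))
    ⟨div_nonneg (sub_nonneg.2 hx.2) hba.le, (div_le_one hba).2 (by linarith [hx.1])⟩
  have ht : 1 - (b - x) / (b - a) = (x - a) / (b - a) := by field_simp; ring
  have hcomb : (b - x) / (b - a) * a + (x - a) / (b - a) * b = x := by field_simp; ring
  rwa [ht, hcomb] at h


/-- Theorem 7 of the paper: for `s`-convex (second sense) functions `f, g` and
`α + β = 1`,
`(1/(b-a)) ∫_a^b f(x)^α g(x)^β dx ≤ (1/(s+1))[α(f(a)+f(b)) + β(g(a)+g(b))]`. -/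
theorem stmt_9 (a b s α β : ℝ) (f g : ℝ → ℝ)
    (ha : 0 ≤ a) (hab : a < b)
    (hs : s ∈ Set.Ioc (0 : ℝ) 1)
    (hα : 0 < α) (hβ : 0 < β) (hαβ : α + β = 1)
    (hf0 : ∀ x, 0 ≤ x → 0 ≤ f x) (hg0 : ∀ x, 0 ≤ x → 0 ≤ g x)
    (hf : ∀ x, 0 ≤ x → ∀ y, 0 ≤ y → ∀ t ∈ Set.Icc (0 : ℝ) 1,
      f (t * x + (1 - t) * y) ≤ t ^ s * f x + (1 - t) ^ s * f y)
    (hg : ∀ x, 0 ≤ x → ∀ y, 0 ≤ y → ∀ t ∈ Set.Icc (0 : ℝ) 1,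
      g (t * x + (1 - t) * y) ≤ t ^ s * g x + (1 - t) ^ s * g y)
    (hint : IntervalIntegrable (fun x => f x ^ α * g x ^ β)
      MeasureTheory.volume a b) :
    (1 / (b - a)) * ∫ x in a..b, f x ^ α * g x ^ β
      ≤ (1 / (s + 1)) * (α * (f a + f b) + β * (g a + g b)) := by
  have hba : 0 < b - a := sub_pos.2 hab
  have hbound : ∀ x ∈ Set.Icc a b, f x ^ α * g x ^ β ≤
      ((b - x) / (b - a)) ^ s * (α * f a + β * g a) +
        ((x - a) / (b - a)) ^ s * (α * f b + β * g b) := by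
    intro x hx
    have hx0 : 0 ≤ x := ha.trans hx.1
    have hamgm := Real.geom_mean_le_arith_mean2_weighted hα.le hβ.le (hf0 x hx0) (hg0 x hx0) hαβ
    have hfx := mul_le_mul_of_nonneg_left (le_rpow_interpolation ha hab hx hf) hα.le
    have hgx := mul_le_mul_of_nonneg_left (le_rpow_interpolation ha hab hx hg) hβ.le
    linarith
  have hleft : IntervalIntegrable
      (fun x => ((b - x) / (b - a)) ^ s * (α * f a + β * g a)) MeasureTheory.volume a b :=
    ((((continuous_const.sub continuous_id).div_const _).rpow_const
      fun _ => Or.inr hs.1.le).mul_const _).intervalIntegrable a b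
  have hright : IntervalIntegrable
      (fun x => ((x - a) / (b - a)) ^ s * (α * f b + β * g b)) MeasureTheory.volume a b :=
    ((((continuous_id.sub continuous_const).div_const _).rpow_const
      fun _ => Or.inr hs.1.le).mul_const _).intervalIntegrable a b
  have hmono := intervalIntegral.integral_mono_on hab.le hint (hleft.add hright) hbound
  rw [intervalIntegral.integral_add hleft hright, intervalIntegral.integral_mul_const,
    intervalIntegral.integral_mul_const, integral_sub_right_div_rpow hab hs.1,
    integral_sub_left_div_rpow hab hs.1] at hmono
  rw [one_div_mul_eq_div, div_le_iff₀ hba]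
  exact hmono.trans_eq (by ring)
end

section
/- Let a < b, let α, β > 0 with α + β = 1, and suppose f, g : [a,b] → (0,∞) are log-convex functions with f(a) ≠ f(b) and g(a) ≠ g(b), such that x ↦ f(x)^α · g(x)^β is integrable on [a,b]. Then (1/(b-a)) ∫_a^b f(x)^α g(x)^β dx ≤ α L(f(a), f(b)) + β L(g(a), g(b)), where L(u,v) = (u - v)/(ln u - ln v) is the logarithmic mean of distinct positive reals u, v. -/
/-- The logarithmic mean of two distinct positive reals. -/
noncomputable def logMean (u v : ℝ) : ℝ := (u - v) / (Real.log u - Real.log v)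

/-- The weighted geometric mean of `u` and `v`, written as an exponential. -/
theorem rpow_mul_rpow_one_sub_eq_exp {u v : ℝ} (hu : 0 < u) (hv : 0 < v) (t : ℝ) :
    u ^ t * v ^ (1 - t) = Real.exp (Real.log u * t + Real.log v * (1 - t)) := by
  rw [Real.rpow_def_of_pos hu, Real.rpow_def_of_pos hv, Real.exp_add]

theorem continuous_geometric_interpolation {u v : ℝ} (hu : 0 < u) (hv : 0 < v) (a b : ℝ) :
    Continuous fun x : ℝ => u ^ ((b - x) / (b - a)) * v ^ (1 - (b - x) / (b - a)) := by
  simp only [rpow_mul_rpow_one_sub_eq_exp hu hv]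
  fun_prop

/-- The integral of the geometric interpolation is given by the logarithmic mean. -/
theorem integral_geometric_interpolation {a b u v : ℝ} (hab : a < b) (hu : 0 < u) (hv : 0 < v)
    (huv : u ≠ v) :
    ∫ x in a..b, u ^ ((b - x) / (b - a)) * v ^ (1 - (b - x) / (b - a))
      = (b - a) * logMean u v := by
  have hlog : Real.log u - Real.log v ≠ 0 :=
    sub_ne_zero.mpr fun h => huv (Real.log_injOn_pos hu hv h)
  have hba : b - a ≠ 0 := (sub_pos.mpr hab).ne'
  have hderiv : ∀ x ∈ Set.uIcc a b, HasDerivAt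
      (fun x : ℝ => -((b - a) / (Real.log u - Real.log v)) *
        Real.exp (Real.log u * ((b - x) / (b - a)) + Real.log v * (1 - (b - x) / (b - a))))
      (u ^ ((b - x) / (b - a)) * v ^ (1 - (b - x) / (b - a))) x := by
    intro x _
    have ht : HasDerivAt (fun x : ℝ => (b - x) / (b - a)) (-1 / (b - a)) x :=
      ((hasDerivAt_id x).const_sub b).div_const (b - a)
    refine ((((ht.const_mul (Real.log u)).add
      ((ht.const_sub 1).const_mul (Real.log v))).exp).const_mul
        (-((b - a) / (Real.log u - Real.log v)))).congr_deriv ?_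
    rw [rpow_mul_rpow_one_sub_eq_exp hu hv]
    simp only [Pi.add_apply]
    field_simp
    ring
  rw [intervalIntegral.integral_eq_sub_of_hasDerivAt hderiv
    ((continuous_geometric_interpolation hu hv a b).intervalIntegrable a b)]
  simp only [sub_self, zero_div, div_self hba, mul_zero, mul_one, sub_zero, zero_add, add_zero,
    Real.exp_log hu, Real.exp_log hv, logMean]
  field_simp
  ring

/-- A log-convex function lies below the geometric interpolation of its endpoint values. -/
theorem le_geometric_interpolation {a b : ℝ} {f : ℝ → ℝ} (hab : a < b)
    (hf : ∀ x ∈ Set.Icc a b, ∀ y ∈ Set.Icc a b, ∀ t ∈ Set.Icc (0 : ℝ) 1,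
      f (t * x + (1 - t) * y) ≤ f x ^ t * f y ^ (1 - t))
    {x : ℝ} (hx : x ∈ Set.Icc a b) :
    f x ≤ f a ^ ((b - x) / (b - a)) * f b ^ (1 - (b - x) / (b - a)) := by
  have hba : 0 < b - a := sub_pos.mpr hab
  have h := hf a (Set.left_mem_Icc.mpr hab.le) b (Set.right_mem_Icc.mpr hab.le)
    ((b - x) / (b - a)) ⟨div_nonneg (sub_nonneg.mpr hx.2) hba.le,
      (div_le_one hba).mpr (by linarith [hx.1])⟩
  have hcomb : (b - x) / (b - a) * a + (1 - (b - x) / (b - a)) * b = x := by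
    field_simp
    ring
  rwa [hcomb] at h

/-- Theorem 8 of the paper: for log-convex functions `f, g` on `[a,b]` and
`α + β = 1`,
`(1/(b-a)) ∫_a^b f(x)^α g(x)^β dx ≤ α L(f(a), f(b)) + β L(g(a), g(b))`. -/
theorem stmt_10 (a b α β : ℝ) (f g : ℝ → ℝ)
    (hab : a < b)
    (hα : 0 < α) (hβ : 0 < β) (hαβ : α + β = 1)
    (hfpos : ∀ x ∈ Set.Icc a b, 0 < f x) (hgpos : ∀ x ∈ Set.Icc a b, 0 < g x)
    (hfab : f a ≠ f b) (hgab : g a ≠ g b)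
    (hf : ∀ x ∈ Set.Icc a b, ∀ y ∈ Set.Icc a b, ∀ t ∈ Set.Icc (0 : ℝ) 1,
      f (t * x + (1 - t) * y) ≤ f x ^ t * f y ^ (1 - t))
    (hg : ∀ x ∈ Set.Icc a b, ∀ y ∈ Set.Icc a b, ∀ t ∈ Set.Icc (0 : ℝ) 1,
      g (t * x + (1 - t) * y) ≤ g x ^ t * g y ^ (1 - t))
    (hint : IntervalIntegrable (fun x => f x ^ α * g x ^ β)
      MeasureTheory.volume a b) :
    (1 / (b - a)) * ∫ x in a..b, f x ^ α * g x ^ β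
      ≤ α * logMean (f a) (f b) + β * logMean (g a) (g b) := by
  have ha : a ∈ Set.Icc a b := Set.left_mem_Icc.mpr hab.le
  have hb : b ∈ Set.Icc a b := Set.right_mem_Icc.mpr hab.le
  have hF := ((continuous_geometric_interpolation (hfpos a ha) (hfpos b hb) a b).intervalIntegrable
    (μ := MeasureTheory.volume) a b).const_mul α
  have hG := ((continuous_geometric_interpolation (hgpos a ha) (hgpos b hb) a b).intervalIntegrable
    (μ := MeasureTheory.volume) a b).const_mul β
  have hmono := intervalIntegral.integral_mono_on hab.le hint (hF.add hG) fun x hx =>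
    (Real.geom_mean_le_arith_mean2_weighted hα.le hβ.le (hfpos x hx).le (hgpos x hx).le hαβ).trans
      (add_le_add (mul_le_mul_of_nonneg_left (le_geometric_interpolation hab hf hx) hα.le)
        (mul_le_mul_of_nonneg_left (le_geometric_interpolation hab hg hx) hβ.le))
  rw [intervalIntegral.integral_add hF hG, intervalIntegral.integral_const_mul,
    intervalIntegral.integral_const_mul,
    integral_geometric_interpolation hab (hfpos a ha) (hfpos b hb) hfab,
    integral_geometric_interpolation hab (hgpos a ha) (hgpos b hb) hgab] at hmono
  rw [one_div_mul_eq_div, div_le_iff₀ (sub_pos.mpr hab)]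
  linarith
end

section
/- Let 0 ≤ a < b < ∞ and let (α₁, m₁), (α₂, m₂) ∈ (0,1]². Suppose f, g : [0,∞) → [0,∞) are (α₁,m₁)-convex and (α₂,m₂)-convex respectively, and that the function x ↦ f(x)^((x-a)/(b-a)) · g(x)^((b-x)/(b-a)) is integrable on [a,b]. Then (1/(b-a)) ∫_a^b f(x)^((x-a)/(b-a)) g(x)^((b-x)/(b-a)) dx ≤ (1/(α₁+2)) f(b) + (m₁ α₁/(2(α₁+2))) f(a/m₁) + (1/((α₂+1)(α₂+2))) g(b) + (m₂(α₂² + 3α₂)/(2(α₂+1)(α₂+2))) g(a/m₂). -/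
open intervalIntegral in
/-- The first moment of the unit-interval majorant `t ^ α * A + m * (1 - t ^ α) * B`. -/
theorem integral_id_mul_rpow_majorant {α : ℝ} (hα : 0 < α) (m A B : ℝ) :
    ∫ t in (0 : ℝ)..1, t * (t ^ α * A + m * (1 - t ^ α) * B)
      = (1 / (α + 2)) * A + (m * α / (2 * (α + 2))) * B := by
  have hc : Continuous fun t : ℝ => t ^ (α + 1) :=
    Real.continuous_rpow_const (by linarith)
  have heq : ∫ t in (0 : ℝ)..1, t * (t ^ α * A + m * (1 - t ^ α) * B)
      = ∫ t in (0 : ℝ)..1, (t ^ (α + 1) * (A - m * B) + t * (m * B)) := by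
    refine integral_congr fun t ht => ?_
    rw [Set.uIcc_of_le zero_le_one] at ht
    simp only [Real.rpow_add_one' ht.1 (by linarith : α + 1 ≠ 0)]
    ring
  rw [heq, integral_add (Continuous.intervalIntegrable (by fun_prop) _ _)
    (Continuous.intervalIntegrable (by fun_prop) _ _), integral_mul_const,
    integral_mul_const, integral_id, integral_rpow (Or.inl (by linarith)), Real.one_rpow,
    Real.zero_rpow (by linarith)]
  field_simp
  ring

open intervalIntegral in
/-- The integral of the unit-interval majorant. -/
theorem integral_rpow_majorant {α : ℝ} (hα : 0 < α) (m A B : ℝ) :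
    ∫ t in (0 : ℝ)..1, (t ^ α * A + m * (1 - t ^ α) * B)
      = (1 / (α + 1)) * A + (m * α / (α + 1)) * B := by
  have hc : Continuous fun t : ℝ => t ^ α := Real.continuous_rpow_const hα.le
  have heq : ∫ t in (0 : ℝ)..1, (t ^ α * A + m * (1 - t ^ α) * B)
      = ∫ t in (0 : ℝ)..1, (t ^ α * (A - m * B) + m * B) :=
    integral_congr fun t _ => by ring
  rw [heq, integral_add (Continuous.intervalIntegrable (by fun_prop) _ _)
    (Continuous.intervalIntegrable (by fun_prop) _ _), integral_mul_const,
    integral_const, integral_rpow (Or.inl (by linarith)), Real.one_rpow,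
    Real.zero_rpow (by linarith), smul_eq_mul]
  field_simp
  ring

open intervalIntegral in
/-- The moment of the unit-interval majorant against `1 - t`. -/
theorem integral_one_sub_mul_rpow_majorant {α : ℝ} (hα : 0 < α) (m A B : ℝ) :
    ∫ t in (0 : ℝ)..1, (1 - t) * (t ^ α * A + m * (1 - t ^ α) * B)
      = (1 / ((α + 1) * (α + 2))) * A
        + (m * (α ^ 2 + 3 * α) / (2 * (α + 1) * (α + 2))) * B := by
  have hc : Continuous fun t : ℝ => t ^ α := Real.continuous_rpow_const hα.le
  have hM : Continuous fun t : ℝ => t ^ α * A + m * (1 - t ^ α) * B := by fun_prop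
  simp only [sub_mul (1 : ℝ), one_mul]
  rw [integral_sub, integral_id_mul_rpow_majorant hα]
  · have := integral_rpow_majorant hα m A B
    simp only [sub_mul, mul_sub, mul_one] at this ⊢
    rw [this]
    field_simp
    ring
  · have h := hM.intervalIntegrable (μ := MeasureTheory.volume) 0 1
    simpa only [sub_mul, mul_sub, one_mul] using h
  · exact (continuous_id.mul hM).intervalIntegrable _ _

/-- An `(α,m)`-convex function on `[a, b]` is dominated by its majorant between `b` and `a / m`. -/
theorem le_majorant_of_alpha_m_convex {a b α m : ℝ} {f : ℝ → ℝ} (ha : 0 ≤ a) (hab : a < b)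
    (hm : 0 < m)
    (hf : ∀ x, 0 ≤ x → ∀ y, 0 ≤ y → ∀ t ∈ Set.Icc (0 : ℝ) 1,
      f (t * x + m * (1 - t) * y) ≤ t ^ α * f x + m * (1 - t ^ α) * f y)
    {x : ℝ} (hx : x ∈ Set.Icc a b) :
    f x ≤ ((x - a) / (b - a)) ^ α * f b + m * (1 - ((x - a) / (b - a)) ^ α) * f (a / m) := by
  have hba : 0 < b - a := sub_pos.2 hab
  have h := hf b (ha.trans hab.le) (a / m) (by positivity) ((x - a) / (b - a))
    ⟨div_nonneg (sub_nonneg.2 hx.1) hba.le, (div_le_one hba).2 (by linarith [hx.2])⟩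
  have hxe : (x - a) / (b - a) * b + m * (1 - (x - a) / (b - a)) * (a / m) = x := by
    field_simp
    ring
  rwa [hxe] at h


/-- Theorem 9 of the paper: for `(α₁,m₁)`-convex `f` and `(α₂,m₂)`-convex `g`
(nonnegative on `[0,∞)`),
`(1/(b-a)) ∫_a^b f(x)^((x-a)/(b-a)) g(x)^((b-x)/(b-a)) dx
  ≤ f(b)/(α₁+2) + m₁α₁ f(a/m₁)/(2(α₁+2)) + g(b)/((α₂+1)(α₂+2))
    + m₂(α₂²+3α₂) g(a/m₂)/(2(α₂+1)(α₂+2))`. -/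
theorem stmt_11 (a b α₁ m₁ α₂ m₂ : ℝ) (f g : ℝ → ℝ)
    (ha : 0 ≤ a) (hab : a < b)
    (hα₁ : α₁ ∈ Set.Ioc (0 : ℝ) 1) (hm₁ : m₁ ∈ Set.Ioc (0 : ℝ) 1)
    (hα₂ : α₂ ∈ Set.Ioc (0 : ℝ) 1) (hm₂ : m₂ ∈ Set.Ioc (0 : ℝ) 1)
    (hf0 : ∀ x, 0 ≤ x → 0 ≤ f x) (hg0 : ∀ x, 0 ≤ x → 0 ≤ g x)
    (hf : ∀ x, 0 ≤ x → ∀ y, 0 ≤ y → ∀ t ∈ Set.Icc (0 : ℝ) 1,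
      f (t * x + m₁ * (1 - t) * y) ≤ t ^ α₁ * f x + m₁ * (1 - t ^ α₁) * f y)
    (hg : ∀ x, 0 ≤ x → ∀ y, 0 ≤ y → ∀ t ∈ Set.Icc (0 : ℝ) 1,
      g (t * x + m₂ * (1 - t) * y) ≤ t ^ α₂ * g x + m₂ * (1 - t ^ α₂) * g y)
    (hint : IntervalIntegrable
      (fun x => f x ^ ((x - a) / (b - a)) * g x ^ ((b - x) / (b - a)))
      MeasureTheory.volume a b) :
    (1 / (b - a)) * ∫ x in a..b, f x ^ ((x - a) / (b - a)) * g x ^ ((b - x) / (b - a))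
      ≤ (1 / (α₁ + 2)) * f b + (m₁ * α₁ / (2 * (α₁ + 2))) * f (a / m₁)
        + (1 / ((α₂ + 1) * (α₂ + 2))) * g b
        + (m₂ * (α₂ ^ 2 + 3 * α₂) / (2 * (α₂ + 1) * (α₂ + 2))) * g (a / m₂) := by
  have hba : 0 < b - a := sub_pos.2 hab
  set M₁ : ℝ → ℝ := fun t => t ^ α₁ * f b + m₁ * (1 - t ^ α₁) * f (a / m₁) with hM₁
  set M₂ : ℝ → ℝ := fun t => t ^ α₂ * g b + m₂ * (1 - t ^ α₂) * g (a / m₂) with hM₂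
  have hc₁ : Continuous M₁ := by
    have : Continuous fun t : ℝ => t ^ α₁ := Real.continuous_rpow_const hα₁.1.le
    fun_prop
  have hc₂ : Continuous M₂ := by
    have : Continuous fun t : ℝ => t ^ α₂ := Real.continuous_rpow_const hα₂.1.le
    fun_prop
  have hle : ∫ x in a..b, f x ^ ((x - a) / (b - a)) * g x ^ ((b - x) / (b - a))
      ≤ ∫ x in a..b, ((x - a) / (b - a) * M₁ ((x - a) / (b - a))
        + (1 - (x - a) / (b - a)) * M₂ ((x - a) / (b - a))) := by
    refine intervalIntegral.integral_mono_on hab.le hint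
      (Continuous.intervalIntegrable (by fun_prop) _ _) fun x hx => ?_
    have hx0 : 0 ≤ x := ha.trans hx.1
    have ht : 0 ≤ (x - a) / (b - a) := div_nonneg (sub_nonneg.2 hx.1) hba.le
    have hs : 0 ≤ (b - x) / (b - a) := div_nonneg (sub_nonneg.2 hx.2) hba.le
    have hst : (b - x) / (b - a) = 1 - (x - a) / (b - a) := by
      field_simp
      ring
    rw [hst] at hs ⊢
    refine (Real.geom_mean_le_arith_mean2_weighted ht hs (hf0 x hx0) (hg0 x hx0)
      (by ring)).trans ?_
    gcongr
    · exact le_majorant_of_alpha_m_convex ha hab hm₁.1 hf hx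
    · exact le_majorant_of_alpha_m_convex ha hab hm₂.1 hg hx
  have hsub : ∫ x in a..b, ((x - a) / (b - a) * M₁ ((x - a) / (b - a))
        + (1 - (x - a) / (b - a)) * M₂ ((x - a) / (b - a)))
      = (b - a) * ∫ t in (0 : ℝ)..1, (t * M₁ t + (1 - t) * M₂ t) := by
    have h := intervalIntegral.integral_comp_div_sub (a := a) (b := b)
      (fun t => t * M₁ t + (1 - t) * M₂ t) hba.ne' (a / (b - a))
    simp only [← sub_div, sub_self, div_self hba.ne', smul_eq_mul] at h
    exact h
  rw [hsub, intervalIntegral.integral_add (Continuous.intervalIntegrable (by fun_prop) _ _)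
    (Continuous.intervalIntegrable (by fun_prop) _ _), hM₁, hM₂,
    integral_id_mul_rpow_majorant hα₁.1, integral_one_sub_mul_rpow_majorant hα₂.1] at hle
  rw [one_div_mul_eq_div, div_le_iff₀ hba]
  linarith
end

section
/- Let a < b, let p ≥ 1, and suppose f, g : [a,b] → (0,∞) are functions with f^p and g^p integrable on [a,b], and there exist constants 0 < m ≤ M such that m ≤ f(x)/g(x) ≤ M for all x ∈ [a,b]. Then (∫_a^b f(x)^p dx)^(1/p) + (∫_a^b g(x)^p dx)^(1/p) ≤ c · (∫_a^b (f(x) + g(x))^p dx)^(1/p), where c = (M(m+1) + (M+1))/((m+1)(M+1)). -/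
/-- Monotonicity and homogeneity of the `L^p` norm on `[a, b]`: a pointwise bound `u ≤ k v`
passes to the norms. -/
theorem rpow_integral_rpow_le_mul {a b p k : ℝ} {u v : ℝ → ℝ} (hab : a ≤ b) (hp : 0 < p)
    (hk : 0 ≤ k) (hu : ∀ x ∈ Set.Icc a b, 0 ≤ u x) (hv : ∀ x ∈ Set.Icc a b, 0 ≤ v x)
    (huv : ∀ x ∈ Set.Icc a b, u x ≤ k * v x)
    (hui : IntervalIntegrable (fun x => u x ^ p) MeasureTheory.volume a b)
    (hvi : IntervalIntegrable (fun x => v x ^ p) MeasureTheory.volume a b) :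
    (∫ x in a..b, u x ^ p) ^ (1 / p) ≤ k * (∫ x in a..b, v x ^ p) ^ (1 / p) := by
  have hle : ∫ x in a..b, u x ^ p ≤ k ^ p * ∫ x in a..b, v x ^ p := by
    rw [← intervalIntegral.integral_const_mul]
    refine intervalIntegral.integral_mono_on hab hui (hvi.const_mul _) fun x hx => ?_
    rw [← Real.mul_rpow hk (hv x hx)]
    exact Real.rpow_le_rpow (hu x hx) (huv x hx) hp.le
  have hu0 : 0 ≤ ∫ x in a..b, u x ^ p :=
    intervalIntegral.integral_nonneg hab fun x hx => Real.rpow_nonneg (hu x hx) p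
  have hv0 : 0 ≤ ∫ x in a..b, v x ^ p :=
    intervalIntegral.integral_nonneg hab fun x hx => Real.rpow_nonneg (hv x hx) p
  calc (∫ x in a..b, u x ^ p) ^ (1 / p)
      ≤ (k ^ p * ∫ x in a..b, v x ^ p) ^ (1 / p) :=
        Real.rpow_le_rpow hu0 hle (by positivity)
    _ = k * (∫ x in a..b, v x ^ p) ^ (1 / p) := by
        rw [Real.mul_rpow (Real.rpow_nonneg hk p) hv0, one_div, Real.rpow_rpow_inv hk (ne_of_gt hp)]

/-- A nonnegative function is a.e. strongly measurable as soon as one of its positive powers is. -/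
theorem aestronglyMeasurable_of_rpow {α : Type*} [MeasurableSpace α]
    {μ : MeasureTheory.Measure α} {p : ℝ} {u : α → ℝ} (hp : p ≠ 0) (hu : ∀ᵐ x ∂μ, 0 ≤ u x)
    (h : MeasureTheory.AEStronglyMeasurable (fun x => u x ^ p) μ) :
    MeasureTheory.AEStronglyMeasurable u μ := by
  refine ((h.aemeasurable.pow_const p⁻¹).aestronglyMeasurable).congr ?_
  filter_upwards [hu] with x hx using Real.rpow_rpow_inv hx hp

/-- If `u` and `v` are nonnegative on `[a, b]` with `u ≤ k v`, and `u ^ p`, `v ^ p` are integrable,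
then so is `(u + v) ^ p`. -/
theorem intervalIntegrable_add_rpow {a b p k : ℝ} {u v : ℝ → ℝ} (hab : a ≤ b) (hp : 0 < p)
    (hk : 0 ≤ k) (hu : ∀ x ∈ Set.Icc a b, 0 ≤ u x) (hv : ∀ x ∈ Set.Icc a b, 0 ≤ v x)
    (huv : ∀ x ∈ Set.Icc a b, u x ≤ k * v x)
    (hui : IntervalIntegrable (fun x => u x ^ p) MeasureTheory.volume a b)
    (hvi : IntervalIntegrable (fun x => v x ^ p) MeasureTheory.volume a b) :
    IntervalIntegrable (fun x => (u x + v x) ^ p) MeasureTheory.volume a b := by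
  rw [intervalIntegrable_iff_integrableOn_Ioc_of_le hab] at hui hvi ⊢
  have hmem : ∀ᵐ x ∂MeasureTheory.volume.restrict (Set.Ioc a b), x ∈ Set.Icc a b := by
    filter_upwards [MeasureTheory.ae_restrict_mem measurableSet_Ioc] with x hx
      using Set.Ioc_subset_Icc_self hx
  have hum := aestronglyMeasurable_of_rpow hp.ne' (hmem.mono hu) hui.aestronglyMeasurable
  have hvm := aestronglyMeasurable_of_rpow hp.ne' (hmem.mono hv) hvi.aestronglyMeasurable
  refine (hvi.const_mul ((k + 1) ^ p)).mono'
    ((hum.add hvm).aemeasurable.pow_const p).aestronglyMeasurable ?_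
  filter_upwards [hmem] with x hx
  have hux := hu x hx
  have hvx := hv x hx
  rw [Real.norm_of_nonneg (by positivity), ← Real.mul_rpow (by positivity) hvx]
  exact Real.rpow_le_rpow (by positivity) (by linarith [huv x hx]) hp.le

/-- The reverse Minkowski inequality of Bougoffa: for positive functions whose
ratio `f/g` lies in `[m, M]` on `[a,b]`,
`(∫_a^b f^p)^(1/p) + (∫_a^b g^p)^(1/p) ≤ c (∫_a^b (f+g)^p)^(1/p)` with
`c = (M(m+1) + (M+1))/((m+1)(M+1))`. -/
theorem stmt_13 (a b p m M : ℝ) (f g : ℝ → ℝ)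
    (hab : a < b) (hp : 1 ≤ p)
    (hfpos : ∀ x ∈ Set.Icc a b, 0 < f x) (hgpos : ∀ x ∈ Set.Icc a b, 0 < g x)
    (hfpint : IntervalIntegrable (fun x => f x ^ p) MeasureTheory.volume a b)
    (hgpint : IntervalIntegrable (fun x => g x ^ p) MeasureTheory.volume a b)
    (hm : 0 < m) (hmM : m ≤ M)
    (hratio : ∀ x ∈ Set.Icc a b, m ≤ f x / g x ∧ f x / g x ≤ M) :
    (∫ x in a..b, f x ^ p) ^ (1 / p) + (∫ x in a..b, g x ^ p) ^ (1 / p)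
      ≤ ((M * (m + 1) + (M + 1)) / ((m + 1) * (M + 1))) *
          (∫ x in a..b, (f x + g x) ^ p) ^ (1 / p) := by
  have hp0 : 0 < p := by linarith
  have hM : 0 < M := by linarith
  have hf : ∀ x ∈ Set.Icc a b, 0 ≤ f x := fun x hx => (hfpos x hx).le
  have hg : ∀ x ∈ Set.Icc a b, 0 ≤ g x := fun x hx => (hgpos x hx).le
  have hs : ∀ x ∈ Set.Icc a b, 0 ≤ f x + g x := fun x hx => add_nonneg (hf x hx) (hg x hx)
  have hfg : ∀ x ∈ Set.Icc a b, f x ≤ M * g x := fun x hx =>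
    (div_le_iff₀ (hgpos x hx)).1 (hratio x hx).2
  have hgf : ∀ x ∈ Set.Icc a b, m * g x ≤ f x := fun x hx =>
    (le_div_iff₀ (hgpos x hx)).1 (hratio x hx).1
  have hsint := intervalIntegrable_add_rpow hab.le hp0 hM.le hf hg hfg hfpint hgpint
  have hf_le : ∀ x ∈ Set.Icc a b, f x ≤ M / (M + 1) * (f x + g x) := fun x hx => by
    rw [div_mul_eq_mul_div, le_div_iff₀ (by positivity)]
    linarith [hfg x hx]
  have hg_le : ∀ x ∈ Set.Icc a b, g x ≤ 1 / (m + 1) * (f x + g x) := fun x hx => by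
    rw [div_mul_eq_mul_div, le_div_iff₀ (by positivity)]
    linarith [hgf x hx]
  have hc : (M * (m + 1) + (M + 1)) / ((m + 1) * (M + 1)) = M / (M + 1) + 1 / (m + 1) := by
    field_simp
  rw [hc, add_mul]
  exact add_le_add
    (rpow_integral_rpow_le_mul hab.le hp0 (by positivity) hf hs hf_le hfpint hsint)
    (rpow_integral_rpow_le_mul hab.le hp0 (by positivity) hg hs hg_le hgpint hsint)
end

section
/- Let s ∈ (0,1], let 0 ≤ a < b < ∞, and suppose f : [0,∞) → [0,∞) is s-convex in the second sense and integrable on [a,b]. Then 2^(s-1) f((a+b)/2) ≤ (1/(b-a)) ∫_a^b f(x) dx ≤ (f(a) + f(b))/(s+1). -/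
open MeasureTheory intervalIntegral

lemma integral_sub_left_endpoint_rpow {a b s : ℝ} (hs : 0 < s) :
    ∫ x in a..b, (x - a) ^ s = (b - a) ^ (s + 1) / (s + 1) := by
  rw [integral_comp_sub_right (fun x : ℝ => x ^ s), integral_rpow (Or.inl (by linarith)), sub_self,
    Real.zero_rpow (by positivity), sub_zero]

lemma integral_right_endpoint_sub_rpow {a b s : ℝ} (hs : 0 < s) :
    ∫ x in a..b, (b - x) ^ s = (b - a) ^ (s + 1) / (s + 1) := by
  rw [integral_comp_sub_left (fun x : ℝ => x ^ s), integral_rpow (Or.inl (by linarith)), sub_self,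
    Real.zero_rpow (by positivity), sub_zero]

/-- The lower Hermite–Hadamard bound only needs the midpoint inequality on `[a, b]`. -/
lemma mul_apply_midpoint_le_integral {a b c : ℝ} {f : ℝ → ℝ} (hab : a ≤ b)
    (hf : ∀ x ∈ Set.Icc a b, f ((a + b) / 2) ≤ c * (f x + f (a + b - x)))
    (hint : IntervalIntegrable f volume a b) :
    (b - a) * f ((a + b) / 2) ≤ 2 * c * ∫ x in a..b, f x := by
  have hint' : IntervalIntegrable (fun x => f (a + b - x)) volume a b := by
    simpa using (hint.comp_sub_left (a + b)).symm
  have h := integral_mono_on hab intervalIntegrable_const ((hint.add hint').const_mul c) hf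
  simp only [intervalIntegral.integral_const, smul_eq_mul,
    intervalIntegral.integral_const_mul] at h
  rw [integral_add hint hint', integral_comp_sub_left f (a + b)] at h
  simp only [add_sub_cancel_right, add_sub_cancel_left] at h
  linarith

/-- The upper Hermite–Hadamard bound only needs `s`-convexity along the segment `[a, b]`. -/
lemma integral_le_of_le_rpow_combination {a b s : ℝ} {f : ℝ → ℝ} (hs : 0 < s) (hab : a < b)
    (hf : ∀ t ∈ Set.Icc (0 : ℝ) 1, f (t * a + (1 - t) * b) ≤ t ^ s * f a + (1 - t) ^ s * f b)
    (hint : IntervalIntegrable f volume a b) :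
    ∫ x in a..b, f x ≤ (b - a) * ((f a + f b) / (s + 1)) := by
  have hd : 0 < b - a := sub_pos.2 hab
  have hle : ∀ x ∈ Set.Icc a b,
      f x ≤ (b - x) ^ s * (f a / (b - a) ^ s) + (x - a) ^ s * (f b / (b - a) ^ s) := by
    rintro x ⟨hax, hxb⟩
    have h := hf ((b - x) / (b - a))
      ⟨div_nonneg (by linarith) hd.le, (div_le_one hd).2 (by linarith)⟩
    have h1 : 1 - (b - x) / (b - a) = (x - a) / (b - a) := by field_simp; ring
    have hx : (b - x) / (b - a) * a + (x - a) / (b - a) * b = x := by field_simp; ring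
    rw [h1, hx, Real.div_rpow (by linarith) hd.le, Real.div_rpow (by linarith) hd.le] at h
    exact h.trans_eq (by ring)
  have hi₁ : IntervalIntegrable (fun x => (b - x) ^ s * (f a / (b - a) ^ s)) volume a b :=
    (((continuous_const.sub continuous_id).rpow_const fun _ => Or.inr hs.le).mul
      continuous_const).intervalIntegrable _ _
  have hi₂ : IntervalIntegrable (fun x => (x - a) ^ s * (f b / (b - a) ^ s)) volume a b :=
    (((continuous_id.sub continuous_const).rpow_const fun _ => Or.inr hs.le).mul
      continuous_const).intervalIntegrable _ _
  refine (integral_mono_on hab.le hint (hi₁.add hi₂) hle).trans_eq ?_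
  rw [integral_add hi₁ hi₂, intervalIntegral.integral_mul_const,
    intervalIntegral.integral_mul_const, integral_sub_left_endpoint_rpow hs,
    integral_right_endpoint_sub_rpow hs, Real.rpow_add_one hd.ne']
  have := (Real.rpow_pos_of_pos hd s).ne'
  field_simp

/-- The Hermite–Hadamard type inequality of Dragomir and Fitzpatrick for
`s`-convex functions in the second sense:
`2^(s-1) f((a+b)/2) ≤ (1/(b-a)) ∫_a^b f(x) dx ≤ (f(a)+f(b))/(s+1)`. -/
theorem stmt_14 (a b s : ℝ) (f : ℝ → ℝ)
    (hs : s ∈ Set.Ioc (0 : ℝ) 1)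
    (ha : 0 ≤ a) (hab : a < b)
    (hf0 : ∀ x, 0 ≤ x → 0 ≤ f x)
    (hf : ∀ x, 0 ≤ x → ∀ y, 0 ≤ y → ∀ t ∈ Set.Icc (0 : ℝ) 1,
      f (t * x + (1 - t) * y) ≤ t ^ s * f x + (1 - t) ^ s * f y)
    (hint : IntervalIntegrable f MeasureTheory.volume a b) :
    2 ^ (s - 1) * f ((a + b) / 2) ≤ (1 / (b - a)) * ∫ x in a..b, f x ∧
      (1 / (b - a)) * ∫ x in a..b, f x ≤ (f a + f b) / (s + 1) := by
  have hd : 0 < b - a := sub_pos.2 hab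
  have hb : 0 ≤ b := ha.trans hab.le
  constructor
  · have h := mul_apply_midpoint_le_integral (c := (1 / 2) ^ s) hab.le (fun x hx => by
      have h := hf x (ha.trans hx.1) (a + b - x) (by linarith [hx.2]) (1 / 2) (by norm_num)
      have hm : 1 / 2 * x + (1 - 1 / 2) * (a + b - x) = (a + b) / 2 := by ring
      rw [hm, show (1 : ℝ) - 1 / 2 = 1 / 2 by norm_num, ← mul_add] at h
      exact h) hint
    have h2 : (0 : ℝ) < 2 ^ s := by positivity
    rw [Real.div_rpow zero_le_one zero_le_two, Real.one_rpow] at h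
    rw [Real.rpow_sub_one two_ne_zero, one_div_mul_eq_div, le_div_iff₀ hd]
    calc 2 ^ s / 2 * f ((a + b) / 2) * (b - a)
        = 2 ^ s / 2 * ((b - a) * f ((a + b) / 2)) := by ring
      _ ≤ 2 ^ s / 2 * (2 * (1 / 2 ^ s) * ∫ x in a..b, f x) := by gcongr
      _ = ∫ x in a..b, f x := by field_simp
  · rw [one_div_mul_eq_div, div_le_iff₀' hd]
    exact integral_le_of_le_rpow_combination hs.1 hab (hf a ha b hb) hint
end
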